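/- arXiv:1110.2990 — 8 statements merged into one kernel-verified Lean document; each statement's English description precedes it below -/
import Mathlib

section
/- Let n ≥ 1, λ ∈ {1, −1}, and let R : ℝ × ℝ → ℂ^{n×1} be continuously differentiable. Define Q(x,t) = [[0, R(x,t)],[λ R(x,t)†, 0]], Σ₃ = diag(Iₙ, −1), G(x,t,k) = 2kQ − i ∂ₓQ Σ₃ − i Q² Σ₃, and W = diag(−λ Iₙ, 1). Then (i) W Q(x,t) W⁻¹ = −Q(x,t)† for all (x,t), and (ii) if Φ : ℝ × ℝ × ℂ → M_{n+1}(ℂ) is differentiable in (x,t) and satisfies ∂ₓΦ + ik[Σ₃, Φ] = Q Φ and ∂ₜΦ + 2ik²[Σ₃, Φ] = G(·,·,k) Φ for all (x,t,k), then Ψ(x,t,k) := W Φ(x,t,k*)† W⁻¹ satisfies ∂ₓΨ + ik[Σ₃, Ψ] = −Ψ Q and ∂ₜΨ + 2ik²[Σ₃, Ψ] = −Ψ G(·,·,k) for all (x,t,k). -/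
open Matrix Complex

attribute [local instance] Matrix.normedAddCommGroup Matrix.normedSpace

/-- Partial derivative in the first (space) variable. -/
noncomputable def pdx {E : Type*} [NormedAddCommGroup E] [NormedSpace ℝ E]
    (F : ℝ → ℝ → E) (x t : ℝ) : E := deriv (fun y => F y t) x

/-- Partial derivative in the second (time) variable. -/
noncomputable def pdt {E : Type*} [NormedAddCommGroup E] [NormedSpace ℝ E]
    (F : ℝ → ℝ → E) (x t : ℝ) : E := deriv (fun s => F x s) t

/-- The potential `Q(x,t) = [[0, R],[λ R†, 0]]` of the VNLS Lax pair. -/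
noncomputable def Qmat {n : ℕ} (lam : ℝ) (R : ℝ → ℝ → Matrix (Fin n) (Fin 1) ℂ)
    (x t : ℝ) : Matrix (Fin n ⊕ Fin 1) (Fin n ⊕ Fin 1) ℂ :=
  Matrix.fromBlocks 0 (R x t) ((lam : ℂ) • (R x t)ᴴ) 0

/-- `Σ₃ = diag(Iₙ, −1)`. -/
noncomputable def Sigma3 (n : ℕ) : Matrix (Fin n ⊕ Fin 1) (Fin n ⊕ Fin 1) ℂ :=
  Matrix.fromBlocks 1 0 0 (-1)

/-- `G(x,t,k) = 2kQ − i Qₓ Σ₃ − i Q² Σ₃`. -/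
noncomputable def Gmat {n : ℕ} (lam : ℝ) (R : ℝ → ℝ → Matrix (Fin n) (Fin 1) ℂ)
    (k : ℂ) (x t : ℝ) : Matrix (Fin n ⊕ Fin 1) (Fin n ⊕ Fin 1) ℂ :=
  (2 * k) • Qmat lam R x t - Complex.I • (pdx (Qmat lam R) x t * Sigma3 n)
    - Complex.I • (Qmat lam R x t ^ 2 * Sigma3 n)

/-- `W = diag(−λIₙ, 1)`. -/
noncomputable def Wmat (n : ℕ) (lam : ℝ) : Matrix (Fin n ⊕ Fin 1) (Fin n ⊕ Fin 1) ℂ :=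
  Matrix.fromBlocks ((-(lam : ℂ)) • 1) 0 0 1


section helpers

theorem hd_conj {m : Type*} [Fintype m] [DecidableEq m] (A B : Matrix m m ℂ)
    (f : ℝ → Matrix m m ℂ) (f' : Matrix m m ℂ) (x : ℝ) (h : HasDerivAt f f' x) :
    HasDerivAt (fun y => A * (f y)ᴴ * B) (A * f'ᴴ * B) x := by
  let L : Matrix m m ℂ →ₗ[ℝ] Matrix m m ℂ :=
    { toFun := fun M => A * Mᴴ * B
      map_add' := by intro M N; simp [Matrix.mul_add, Matrix.add_mul]
      map_smul' := by intro c M; simp [Matrix.conjTranspose_smul] }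
  exact (LinearMap.toContinuousLinearMap L).hasFDerivAt.comp_hasDerivAt x h

theorem hd_mul {m : Type*} [Fintype m] [DecidableEq m] (A B : Matrix m m ℂ)
    (f : ℝ → Matrix m m ℂ) (f' : Matrix m m ℂ) (x : ℝ) (h : HasDerivAt f f' x) :
    HasDerivAt (fun y => A * (f y) * B) (A * f' * B) x := by
  let L : Matrix m m ℂ →ₗ[ℝ] Matrix m m ℂ :=
    { toFun := fun M => A * M * B
      map_add' := by intro M N; simp [Matrix.mul_add, Matrix.add_mul]
      map_smul' := by intro c M; simp }
  exact (LinearMap.toContinuousLinearMap L).hasFDerivAt.comp_hasDerivAt x h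

theorem diff_Q {n : ℕ} (lam : ℝ) (R : ℝ → ℝ → Matrix (Fin n) (Fin 1) ℂ)
    (hR : ContDiff ℝ 1 (fun p : ℝ × ℝ => R p.1 p.2)) (x t : ℝ) :
    HasDerivAt (fun y => Qmat lam R y t) (pdx (Qmat lam R) x t) x := by
  have h1 : DifferentiableAt ℝ (fun y => R y t) x :=
    ((hR.differentiable (by norm_num)) (x, t)).comp x
      (f := fun y : ℝ => (y, t)) (by fun_prop)
  let L : Matrix (Fin n) (Fin 1) ℂ →ₗ[ℝ] Matrix (Fin n ⊕ Fin 1) (Fin n ⊕ Fin 1) ℂ :=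
    { toFun := fun M => Matrix.fromBlocks 0 M ((lam : ℂ) • Mᴴ) 0
      map_add' := by intro M N; simp [Matrix.fromBlocks_add]
      map_smul' := by
        intro c M
        simp [Matrix.fromBlocks_smul, Matrix.conjTranspose_smul, smul_comm c lam] }
  exact ((LinearMap.toContinuousLinearMap L).differentiableAt.comp x h1).hasDerivAt

theorem W_sq (n : ℕ) (lam : ℝ) (hlam : lam = 1 ∨ lam = -1) :
    Wmat n lam * Wmat n lam = 1 := by
  rcases hlam with rfl | rfl <;>
    simp [Wmat, Matrix.fromBlocks_multiply, Matrix.fromBlocks_one]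

theorem W_inv (n : ℕ) (lam : ℝ) (hlam : lam = 1 ∨ lam = -1) :
    (Wmat n lam)⁻¹ = Wmat n lam := Matrix.inv_eq_right_inv (W_sq n lam hlam)

theorem W_Q {n : ℕ} (lam : ℝ) (hlam : lam = 1 ∨ lam = -1)
    (R : ℝ → ℝ → Matrix (Fin n) (Fin 1) ℂ) (x t : ℝ) :
    Wmat n lam * Qmat lam R x t * Wmat n lam = -(Qmat lam R x t)ᴴ := by
  rcases hlam with rfl | rfl <;>
    simp [Wmat, Qmat, Matrix.fromBlocks_multiply, Matrix.fromBlocks_conjTranspose,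
      Matrix.fromBlocks_neg]

theorem W_QH {n : ℕ} (lam : ℝ) (hlam : lam = 1 ∨ lam = -1)
    (R : ℝ → ℝ → Matrix (Fin n) (Fin 1) ℂ) (x t : ℝ) :
    Wmat n lam * (Qmat lam R x t)ᴴ * Wmat n lam = -(Qmat lam R x t) := by
  rcases hlam with rfl | rfl <;>
    simp [Wmat, Qmat, Matrix.fromBlocks_multiply, Matrix.fromBlocks_conjTranspose,
      Matrix.fromBlocks_neg]

theorem S_sq (n : ℕ) : Sigma3 n * Sigma3 n = 1 := by
  simp [Sigma3, Matrix.fromBlocks_multiply, Matrix.fromBlocks_one]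

theorem S_H (n : ℕ) : (Sigma3 n)ᴴ = Sigma3 n := by
  simp [Sigma3, Matrix.fromBlocks_conjTranspose]

theorem S_W (n : ℕ) (lam : ℝ) : Sigma3 n * Wmat n lam = Wmat n lam * Sigma3 n := by
  simp [Sigma3, Wmat, Matrix.fromBlocks_multiply]

theorem S_Q {n : ℕ} (lam : ℝ) (R : ℝ → ℝ → Matrix (Fin n) (Fin 1) ℂ) (x t : ℝ) :
    Sigma3 n * Qmat lam R x t * Sigma3 n = -Qmat lam R x t := by
  simp [Sigma3, Qmat, Matrix.fromBlocks_multiply, Matrix.fromBlocks_neg]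

theorem W_QxH {n : ℕ} (lam : ℝ) (hlam : lam = 1 ∨ lam = -1)
    (R : ℝ → ℝ → Matrix (Fin n) (Fin 1) ℂ)
    (hR : ContDiff ℝ 1 (fun p : ℝ × ℝ => R p.1 p.2)) (x t : ℝ) :
    Wmat n lam * (pdx (Qmat lam R) x t)ᴴ * Wmat n lam = -(pdx (Qmat lam R) x t) := by
  have h := diff_Q lam R hR x t
  have h2 := hd_conj (Wmat n lam) (Wmat n lam) _ _ _ h
  simp only [W_QH lam hlam] at h2
  exact h2.unique h.neg

theorem S_Qx {n : ℕ} (lam : ℝ) (R : ℝ → ℝ → Matrix (Fin n) (Fin 1) ℂ)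
    (hR : ContDiff ℝ 1 (fun p : ℝ × ℝ => R p.1 p.2)) (x t : ℝ) :
    Sigma3 n * pdx (Qmat lam R) x t * Sigma3 n = -(pdx (Qmat lam R) x t) := by
  have h := diff_Q lam R hR x t
  have h2 := hd_mul (Sigma3 n) (Sigma3 n) _ _ _ h
  simp only [S_Q] at h2
  exact h2.unique h.neg

theorem anti_of {m : Type*} [Fintype m] [DecidableEq m] (S Q : Matrix m m ℂ)
    (hS : S * S = 1) (h : S * Q * S = -Q) : S * Q = -(Q * S) := by
  calc S * Q = S * Q * (S * S) := by rw [hS, mul_one]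
    _ = (S * Q * S) * S := by simp only [mul_assoc]
    _ = _ := by rw [h, neg_mul]

theorem W_GH {n : ℕ} (lam : ℝ) (hlam : lam = 1 ∨ lam = -1)
    (R : ℝ → ℝ → Matrix (Fin n) (Fin 1) ℂ)
    (hR : ContDiff ℝ 1 (fun p : ℝ × ℝ => R p.1 p.2)) (k : ℂ) (x t : ℝ) :
    Wmat n lam * (Gmat lam R (starRingEnd ℂ k) x t)ᴴ * Wmat n lam
      = -(Gmat lam R k x t) := by
  have hW := W_sq n lam hlam
  have h1 := W_QH lam hlam R x t
  have h2 := W_QxH lam hlam R hR x t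
  have h3 := anti_of _ _ (S_sq n) (S_Q lam R x t)
  have h4 := anti_of _ _ (S_sq n) (S_Qx lam R hR x t)
  have h5 := S_W n lam
  have hS := S_H n
  unfold Gmat
  generalize Qmat lam R x t = Q at *
  generalize pdx (Qmat lam R) x t = P at *
  generalize Wmat n lam = W at *
  generalize Sigma3 n = S at *
  have e2 : W * (S * Pᴴ) * W = P * S := by
    calc W * (S * Pᴴ) * W = (W * S) * Pᴴ * W := by simp only [mul_assoc]
      _ = S * (W * Pᴴ * W) := by rw [← h5]; simp only [mul_assoc]
      _ = P * S := by rw [h2, mul_neg, h4, neg_neg]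
  have e3 : W * (S * (Qᴴ * Qᴴ)) * W = Q * Q * S := by
    calc W * (S * (Qᴴ * Qᴴ)) * W = (W * S) * Qᴴ * (1 * Qᴴ) * W := by
          simp only [mul_assoc, one_mul]
      _ = S * ((W * Qᴴ * W) * (W * Qᴴ * W)) := by
          rw [← h5, ← hW]; simp only [mul_assoc]
      _ = (S * Q) * Q := by rw [h1]; simp only [mul_assoc, neg_mul_neg]
      _ = Q * Q * S := by rw [h3, neg_mul, mul_assoc, h3, mul_neg, neg_neg, mul_assoc]
  simp only [conjTranspose_sub, conjTranspose_smul, conjTranspose_mul, hS, pow_two,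
    mul_sub, sub_mul, Matrix.mul_smul, Matrix.smul_mul, e2, e3, h1]
  simp
  abel

theorem main_alg {m : Type*} [Fintype m] [DecidableEq m] (W S F D Q Q' : Matrix m m ℂ) (c : ℂ)
    (hW : W * W = 1) (hS : Sᴴ = S) (hSW : S * W = W * S)
    (hQ : W * Q'ᴴ * W = -Q) (h : D + (star (-c)) • (S * F - F * S) = Q' * F) :
    W * Dᴴ * W + c • (S * (W * Fᴴ * W) - (W * Fᴴ * W) * S) = -((W * Fᴴ * W) * Q) := by
  have hD : D = Q' * F - (star (-c)) • (S * F - F * S) := eq_sub_of_add_eq h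
  have e1 : W * (Fᴴ * Q'ᴴ) * W = -((W * Fᴴ * W) * Q) := by
    calc W * (Fᴴ * Q'ᴴ) * W = W * Fᴴ * 1 * Q'ᴴ * W := by simp only [mul_assoc, one_mul]
      _ = (W * Fᴴ * W) * (W * Q'ᴴ * W) := by rw [← hW]; simp only [mul_assoc]
      _ = _ := by rw [hQ, mul_neg]
  have e2 : W * (Fᴴ * S) * W = (W * Fᴴ * W) * S := by
    simp only [mul_assoc, hSW]
  have e3 : W * (S * Fᴴ) * W = S * (W * Fᴴ * W) := by
    rw [← mul_assoc W S, ← hSW]; simp only [mul_assoc]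
  rw [hD]
  simp only [conjTranspose_sub, conjTranspose_smul, conjTranspose_mul, hS,
    mul_sub, sub_mul, Matrix.mul_smul, Matrix.smul_mul, e1, e2, e3, star_star, smul_sub, neg_smul, mul_neg, neg_mul]
  abel

end helpers

/-- (i) `W Q W⁻¹ = −Q†`; (ii) if `Φ` solves the Lax pair equations then
`Ψ(x,t,k) = W Φ(x,t,k*)† W⁻¹` solves the adjoint equations
`Ψₓ + ik[Σ₃,Ψ] = −ΨQ`, `Ψₜ + 2ik²[Σ₃,Ψ] = −ΨG`. -/
theorem conjugate_symmetry_lax_pair (n : ℕ) (hn : 1 ≤ n) (lam : ℝ)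
    (hlam : lam = 1 ∨ lam = -1)
    (R : ℝ → ℝ → Matrix (Fin n) (Fin 1) ℂ)
    (hR : ContDiff ℝ 1 (fun p : ℝ × ℝ => R p.1 p.2)) :
    (∀ x t : ℝ,
        Wmat n lam * Qmat lam R x t * (Wmat n lam)⁻¹ = -(Qmat lam R x t)ᴴ)
    ∧
    (∀ Φ : ℝ → ℝ → ℂ → Matrix (Fin n ⊕ Fin 1) (Fin n ⊕ Fin 1) ℂ,
      (∀ k : ℂ, Differentiable ℝ (fun p : ℝ × ℝ => Φ p.1 p.2 k)) →
      (∀ (x t : ℝ) (k : ℂ),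
        pdx (fun x t => Φ x t k) x t
          + (Complex.I * k) • (Sigma3 n * Φ x t k - Φ x t k * Sigma3 n)
          = Qmat lam R x t * Φ x t k) →
      (∀ (x t : ℝ) (k : ℂ),
        pdt (fun x t => Φ x t k) x t
          + (2 * Complex.I * k ^ 2) • (Sigma3 n * Φ x t k - Φ x t k * Sigma3 n)
          = Gmat lam R k x t * Φ x t k) →
      (∀ (x t : ℝ) (k : ℂ),
        (pdx (fun x t => Wmat n lam * (Φ x t (starRingEnd ℂ k))ᴴ * (Wmat n lam)⁻¹) x t
            + (Complex.I * k) •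
              (Sigma3 n * (Wmat n lam * (Φ x t (starRingEnd ℂ k))ᴴ * (Wmat n lam)⁻¹)
                - (Wmat n lam * (Φ x t (starRingEnd ℂ k))ᴴ * (Wmat n lam)⁻¹) * Sigma3 n)
          = -((Wmat n lam * (Φ x t (starRingEnd ℂ k))ᴴ * (Wmat n lam)⁻¹) * Qmat lam R x t))
        ∧
        (pdt (fun x t => Wmat n lam * (Φ x t (starRingEnd ℂ k))ᴴ * (Wmat n lam)⁻¹) x t
            + (2 * Complex.I * k ^ 2) •
              (Sigma3 n * (Wmat n lam * (Φ x t (starRingEnd ℂ k))ᴴ * (Wmat n lam)⁻¹)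
                - (Wmat n lam * (Φ x t (starRingEnd ℂ k))ᴴ * (Wmat n lam)⁻¹) * Sigma3 n)
          = -((Wmat n lam * (Φ x t (starRingEnd ℂ k))ᴴ * (Wmat n lam)⁻¹) * Gmat lam R k x t)))) := by
  have hW := W_sq n lam hlam
  rw [W_inv n lam hlam]
  refine ⟨fun x t => W_Q lam hlam R x t, ?_⟩
  intro Φ hΦ hx ht x t k
  have dx : HasDerivAt (fun y => Φ y t (starRingEnd ℂ k))
      (pdx (fun x t => Φ x t (starRingEnd ℂ k)) x t) x :=
    (((hΦ (starRingEnd ℂ k)) (x, t)).comp x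
      (f := fun y : ℝ => (y, t)) (by fun_prop)).hasDerivAt
  have dt : HasDerivAt (fun s => Φ x s (starRingEnd ℂ k))
      (pdt (fun x t => Φ x t (starRingEnd ℂ k)) x t) t :=
    (((hΦ (starRingEnd ℂ k)) (x, t)).comp t
      (f := fun s : ℝ => (x, s)) (by fun_prop)).hasDerivAt
  have ex : pdx (fun x t => Wmat n lam * (Φ x t (starRingEnd ℂ k))ᴴ * Wmat n lam) x t = _ :=
    (hd_conj (Wmat n lam) (Wmat n lam) _ _ _ dx).deriv
  have et : pdt (fun x t => Wmat n lam * (Φ x t (starRingEnd ℂ k))ᴴ * Wmat n lam) x t = _ :=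
    (hd_conj (Wmat n lam) (Wmat n lam) _ _ _ dt).deriv
  rw [ex, et]
  constructor
  · refine main_alg _ _ _ _ _ _ _ hW (S_H n) (S_W n lam) (W_QH lam hlam R x t) ?_
    rw [← hx]
    simp
  · refine main_alg _ _ _ _ _ _ _ hW (S_H n) (S_W n lam) (W_GH lam hlam R hR k x t) ?_
    rw [← ht]
    simp
end

section
/- Let n ≥ 1, λ ∈ ℝ, k ∈ ℂ, and let R : ℝ → ℂ^{n×1} be continuous. Suppose Φ₁₁ : ℝ → Mₙ(ℂ) and Φ₂₁ : ℝ → M_{1×n}(ℂ) are differentiable, Φ₁₁(x) is invertible for all x, and they satisfy the block equations ∂ₓΦ₁₁ = R Φ₂₁ and ∂ₓΦ₂₁ = 2ik Φ₂₁ + λ R† Φ₁₁ (these are the 11- and 21-blocks of the x-part of the Lax pair ∂ₓΦ + ik[Σ₃,Φ] = QΦ). Then Γ(x) := Φ₂₁(x) Φ₁₁(x)⁻¹ satisfies the Riccati equation ∂ₓΓ = 2ik Γ + λ R† − Γ R Γ on ℝ. -/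
open Matrix Complex

attribute [local instance] Matrix.normedAddCommGroup Matrix.normedSpace

theorem aux_hasDerivAt_iff {m p : ℕ} {A : ℝ → Matrix (Fin m) (Fin p) ℂ}
    {A' : Matrix (Fin m) (Fin p) ℂ} {x : ℝ} :
    HasDerivAt A A' x ↔ ∀ i j, HasDerivAt (fun y => A y i j) (A' i j) x := by
  have h1 : HasDerivAt A A' x ↔ ∀ i, HasDerivAt (fun y => A y i) (A' i) x := hasDerivAt_pi
  rw [h1]
  exact forall_congr' fun i => hasDerivAt_pi

theorem aux_mul {m p q : ℕ} {A : ℝ → Matrix (Fin m) (Fin p) ℂ}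
    {B : ℝ → Matrix (Fin p) (Fin q) ℂ}
    {A' : Matrix (Fin m) (Fin p) ℂ} {B' : Matrix (Fin p) (Fin q) ℂ} {x : ℝ}
    (hA : HasDerivAt A A' x) (hB : HasDerivAt B B' x) :
    HasDerivAt (fun y => A y * B y) (A' * B x + A x * B') x := by
  rw [aux_hasDerivAt_iff] at *
  intro i j
  simp only [Matrix.mul_apply, Matrix.add_apply, ← Finset.sum_add_distrib]
  exact HasDerivAt.fun_sum fun l _ => (hA i l).mul (hB l j)

theorem aux_det {m : ℕ} {A : ℝ → Matrix (Fin m) (Fin m) ℂ} {x : ℝ}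
    (hA : ∀ i j, DifferentiableAt ℝ (fun y => A y i j) x) :
    DifferentiableAt ℝ (fun y => (A y).det) x := by
  simp only [Matrix.det_apply']
  refine DifferentiableAt.fun_sum fun s _ => ?_
  refine (differentiableAt_const _).mul ?_
  exact DifferentiableAt.fun_finsetProd fun i _ => hA _ _

theorem aux_inv {m : ℕ} {A : ℝ → Matrix (Fin m) (Fin m) ℂ} {x : ℝ}
    (hA : ∀ i j, DifferentiableAt ℝ (fun y => A y i j) x) (hu : IsUnit (A x)) :
    ∃ D, HasDerivAt (fun y => (A y)⁻¹) D x := by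
  have key : ∀ i j, DifferentiableAt ℝ (fun y => (A y)⁻¹ i j) x := by
    intro i j
    simp only [Matrix.inv_def, Matrix.smul_apply, Ring.inverse_eq_inv', smul_eq_mul,
      Matrix.adjugate_apply]
    refine DifferentiableAt.mul ((aux_det hA).inv ?_) (aux_det ?_)
    · exact ((Matrix.isUnit_iff_isUnit_det _).1 hu).ne_zero
    · intro a b
      by_cases h : a = j
      · subst h
        simp
      · simp only [Matrix.updateRow_ne h]
        exact hA a b
  exact ⟨Matrix.of fun i j => deriv (fun y => (A y)⁻¹ i j) x,
    aux_hasDerivAt_iff.2 fun i j => (key i j).hasDerivAt⟩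

/-- The quantity `Γ = Φ₂₁ Φ₁₁⁻¹` built from the blocks of a solution of the x-part of the
Lax pair of the vector nonlinear Schrödinger equation satisfies the Riccati equation
`Γₓ = 2ikΓ + λR† − ΓRΓ`. -/
theorem riccati_from_lax_blocks (n : ℕ) (hn : 1 ≤ n) (lam : ℝ) (k : ℂ)
    (R : ℝ → Matrix (Fin n) (Fin 1) ℂ) (hR : Continuous R)
    (Φ₁₁ : ℝ → Matrix (Fin n) (Fin n) ℂ) (Φ₂₁ : ℝ → Matrix (Fin 1) (Fin n) ℂ)
    (hΦ₁₁ : Differentiable ℝ Φ₁₁) (hΦ₂₁ : Differentiable ℝ Φ₂₁)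
    (hinv : ∀ x : ℝ, IsUnit (Φ₁₁ x))
    (heq₁₁ : ∀ x : ℝ, deriv Φ₁₁ x = R x * Φ₂₁ x)
    (heq₂₁ : ∀ x : ℝ,
      deriv Φ₂₁ x = (2 * Complex.I * k) • Φ₂₁ x + (lam : ℂ) • ((R x)ᴴ * Φ₁₁ x)) :
    ∀ x : ℝ,
      deriv (fun y => Φ₂₁ y * (Φ₁₁ y)⁻¹) x
        = (2 * Complex.I * k) • (Φ₂₁ x * (Φ₁₁ x)⁻¹) + (lam : ℂ) • (R x)ᴴ
          - (Φ₂₁ x * (Φ₁₁ x)⁻¹) * R x * (Φ₂₁ x * (Φ₁₁ x)⁻¹) := by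
  intro x
  have h1 : HasDerivAt Φ₁₁ (R x * Φ₂₁ x) x := (hΦ₁₁ x).hasDerivAt.congr_deriv (heq₁₁ x)
  have h2 : HasDerivAt Φ₂₁ ((2 * Complex.I * k) • Φ₂₁ x + (lam : ℂ) • ((R x)ᴴ * Φ₁₁ x)) x :=
    (hΦ₂₁ x).hasDerivAt.congr_deriv (heq₂₁ x)
  obtain ⟨D, hD⟩ := aux_inv
    (fun i j => (aux_hasDerivAt_iff.1 h1 i j).differentiableAt) (hinv x)
  have hdet : ∀ y, IsUnit (Φ₁₁ y).det := fun y => (Matrix.isUnit_iff_isUnit_det _).1 (hinv y)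
  have h3 := aux_mul h1 hD
  have h4 : (fun y => Φ₁₁ y * (Φ₁₁ y)⁻¹) = fun _ => 1 :=
    funext fun y => Matrix.mul_nonsing_inv _ (hdet y)
  rw [h4] at h3
  have h5 := h3.unique (hasDerivAt_const x _)
  have h6 : D = -((Φ₁₁ x)⁻¹ * (R x * Φ₂₁ x * (Φ₁₁ x)⁻¹)) := by
    have h7 := eq_neg_of_add_eq_zero_right h5
    rw [← Matrix.mul_neg, ← h7, ← Matrix.mul_assoc, Matrix.nonsing_inv_mul _ (hdet x),
      Matrix.one_mul]
  refine (aux_mul h2 hD).deriv.trans ?_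
  rw [h6]
  rw [Matrix.add_mul, Matrix.smul_mul, Matrix.smul_mul, Matrix.mul_assoc (R x)ᴴ,
    Matrix.mul_nonsing_inv _ (hdet x), Matrix.mul_one, Matrix.mul_neg, ← sub_eq_add_neg]
  simp only [Matrix.mul_assoc]
end

section
/- Let n ≥ 1 and let R : ℝ × ℝ → ℂ^{n×1}, G₁₁ : ℝ × ℝ → Mₙ(ℂ), G₁₂ : ℝ × ℝ → ℂ^{n×1} be continuously differentiable. Suppose Φ₁₁ : ℝ × ℝ → Mₙ(ℂ) and Φ₂₁ : ℝ × ℝ → M_{1×n}(ℂ) are twice continuously differentiable, Φ₁₁(x,t) is invertible for all (x,t), and ∂ₓΦ₁₁ = R Φ₂₁ and ∂ₜΦ₁₁ = G₁₁ Φ₁₁ + G₁₂ Φ₂₁ hold on ℝ². Then, setting Γ := Φ₂₁ Φ₁₁⁻¹, the local conservation law ∂ₜ tr(R Γ) = ∂ₓ tr(G₁₁ + G₁₂ Γ) holds on ℝ². -/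
open Matrix Complex

attribute [local instance] Matrix.normedAddCommGroup Matrix.normedSpace

theorem aux_generic {R : Type*} [NormedRing R] [NormedAlgebra ℝ R] [CompleteSpace R]
    (T : R →L[ℝ] ℂ) (A B : ℝ → R) (A' B' : R) (t : ℝ)
    (hA : HasDerivAt A A' t) (hB : HasDerivAt B B' t) (hu : IsUnit (A t)) :
    HasDerivAt (fun s => T (B s * Ring.inverse (A s)))
      (T (B' * Ring.inverse (A t) - B t * (Ring.inverse (A t) * A' * Ring.inverse (A t)))) t := by
  obtain ⟨u, hu⟩ := hu
  have h1 := hasFDerivAt_ringInverse (𝕜 := ℝ) u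
  rw [hu] at h1
  have h2 := h1.comp_hasDerivAt t hA
  have h3 := hB.mul h2
  have h4 := T.hasFDerivAt.comp_hasDerivAt t h3
  refine HasDerivAt.congr_deriv h4 ?_
  simp [← hu, sub_eq_add_neg]

/-- Derivative of `tr (B A⁻¹)`. -/
theorem aux_trace_deriv {n : ℕ} (A B : ℝ → Matrix (Fin n) (Fin n) ℂ)
    (A' B' : Matrix (Fin n) (Fin n) ℂ) (t : ℝ)
    (hA : HasDerivAt A A' t) (hB : HasDerivAt B B' t) (hu : IsUnit (A t)) :
    HasDerivAt (fun s => Matrix.trace (B s * (A s)⁻¹))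
      (Matrix.trace (B' * (A t)⁻¹ - B t * ((A t)⁻¹ * A' * (A t)⁻¹))) t := by
  simp only [Matrix.nonsing_inv_eq_ringInverse]
  let T : Matrix (Fin n) (Fin n) ℂ →L[ℝ] ℂ :=
    LinearMap.toContinuousLinearMap (Matrix.traceLinearMap (Fin n) ℝ ℂ)
  have hc : CompleteSpace (Matrix (Fin n) (Fin n) ℂ) := FiniteDimensional.complete ℝ _
  exact @aux_generic (Matrix (Fin n) (Fin n) ℂ) Matrix.linftyOpNormedRing
    Matrix.linftyOpNormedAlgebra hc T A B A' B' t hA hB hu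

theorem aux_partial {E : Type*} [NormedAddCommGroup E] [NormedSpace ℝ E]
    (F : ℝ → ℝ → E) (hF : ContDiff ℝ 2 (fun p : ℝ × ℝ => F p.1 p.2)) (x t : ℝ) :
    HasDerivAt (fun y => F y t) (pdx F x t) x ∧ HasDerivAt (fun s => F x s) (pdt F x t) t ∧
    ∃ M : E, HasDerivAt (fun s => pdx F x s) M t ∧ HasDerivAt (fun y => pdt F y t) M x := by
  set f : ℝ × ℝ → E := fun p => F p.1 p.2 with hf
  have hd : Differentiable ℝ f := hF.differentiable (by norm_num)
  have lx : ∀ x t : ℝ, HasDerivAt (fun y : ℝ => (y, t)) ((1 : ℝ), (0 : ℝ)) x := fun x t =>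
    (hasDerivAt_id x).prodMk (hasDerivAt_const x t)
  have lt : ∀ x t : ℝ, HasDerivAt (fun s : ℝ => (x, s)) ((0 : ℝ), (1 : ℝ)) t := fun x t =>
    (hasDerivAt_const t x).prodMk (hasDerivAt_id t)
  have dx : ∀ x t, HasDerivAt (fun y => F y t) (fderiv ℝ f (x, t) (1, 0)) x := fun x t =>
    HasFDerivAt.comp_hasDerivAt (l := f) x (hd (x, t)).hasFDerivAt (lx x t)
  have dt : ∀ x t, HasDerivAt (fun s => F x s) (fderiv ℝ f (x, t) (0, 1)) t := fun x t =>
    HasFDerivAt.comp_hasDerivAt (l := f) t (hd (x, t)).hasFDerivAt (lt x t)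
  have ex : ∀ x t, pdx F x t = fderiv ℝ f (x, t) (1, 0) := fun x t => (dx x t).deriv
  have et : ∀ x t, pdt F x t = fderiv ℝ f (x, t) (0, 1) := fun x t => (dt x t).deriv
  have hd2 : Differentiable ℝ (fderiv ℝ f) :=
    (hF.fderiv_right (m := 1) (by norm_num)).differentiable (by norm_num)
  have hs : IsSymmSndFDerivAt ℝ f (x, t) :=
    hF.contDiffAt.isSymmSndFDerivAt (by simp)
  refine ⟨by rw [ex]; exact dx x t, by rw [et]; exact dt x t,
    fderiv ℝ (fderiv ℝ f) (x, t) (0, 1) (1, 0), ?_, ?_⟩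
  · simp only [ex]
    have h := (hd2 (x, t)).hasFDerivAt.comp_hasDerivAt t (lt x t)
    exact (ContinuousLinearMap.apply ℝ E ((1 : ℝ), (0 : ℝ))).hasFDerivAt.comp_hasDerivAt t h
  · simp only [et]
    rw [hs.eq]
    have h := (hd2 (x, t)).hasFDerivAt.comp_hasDerivAt x (lx x t)
    exact (ContinuousLinearMap.apply ℝ E ((0 : ℝ), (1 : ℝ))).hasFDerivAt.comp_hasDerivAt x h

/-- The local conservation law `∂ₜ tr(RΓ) = ∂ₓ tr(G₁₁ + G₁₂Γ)`, with `Γ = Φ₂₁Φ₁₁⁻¹`,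
obtained from the 11-blocks `∂ₓΦ₁₁ = RΦ₂₁`, `∂ₜΦ₁₁ = G₁₁Φ₁₁ + G₁₂Φ₂₁` of the Lax pair
of the vector nonlinear Schrödinger equation. -/
theorem local_conservation_law (n : ℕ) (hn : 1 ≤ n)
    (R : ℝ → ℝ → Matrix (Fin n) (Fin 1) ℂ)
    (G₁₁ : ℝ → ℝ → Matrix (Fin n) (Fin n) ℂ)
    (G₁₂ : ℝ → ℝ → Matrix (Fin n) (Fin 1) ℂ)
    (hR : ContDiff ℝ 1 (fun p : ℝ × ℝ => R p.1 p.2))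
    (hG₁₁ : ContDiff ℝ 1 (fun p : ℝ × ℝ => G₁₁ p.1 p.2))
    (hG₁₂ : ContDiff ℝ 1 (fun p : ℝ × ℝ => G₁₂ p.1 p.2))
    (Φ₁₁ : ℝ → ℝ → Matrix (Fin n) (Fin n) ℂ)
    (Φ₂₁ : ℝ → ℝ → Matrix (Fin 1) (Fin n) ℂ)
    (hΦ₁₁ : ContDiff ℝ 2 (fun p : ℝ × ℝ => Φ₁₁ p.1 p.2))
    (hΦ₂₁ : ContDiff ℝ 2 (fun p : ℝ × ℝ => Φ₂₁ p.1 p.2))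
    (hinv : ∀ x t : ℝ, IsUnit (Φ₁₁ x t))
    (heqx : ∀ x t : ℝ, pdx Φ₁₁ x t = R x t * Φ₂₁ x t)
    (heqt : ∀ x t : ℝ, pdt Φ₁₁ x t = G₁₁ x t * Φ₁₁ x t + G₁₂ x t * Φ₂₁ x t) :
    ∀ x t : ℝ,
      pdt (fun x t => Matrix.trace (R x t * (Φ₂₁ x t * (Φ₁₁ x t)⁻¹))) x t
        = pdx (fun x t =>
            Matrix.trace (G₁₁ x t + G₁₂ x t * (Φ₂₁ x t * (Φ₁₁ x t)⁻¹))) x t := by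
  intro x t
  obtain ⟨hx, ht, M, hxt, htx⟩ := aux_partial Φ₁₁ hΦ₁₁ x t
  have e1 : ∀ s, Matrix.trace (R x s * (Φ₂₁ x s * (Φ₁₁ x s)⁻¹))
      = Matrix.trace (pdx Φ₁₁ x s * (Φ₁₁ x s)⁻¹) := fun s => by
    rw [heqx, Matrix.mul_assoc]
  have e2 : ∀ y, Matrix.trace (G₁₁ y t + G₁₂ y t * (Φ₂₁ y t * (Φ₁₁ y t)⁻¹))
      = Matrix.trace (pdt Φ₁₁ y t * (Φ₁₁ y t)⁻¹) := fun y => by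
    rw [heqt, Matrix.add_mul, Matrix.mul_assoc, Matrix.mul_assoc,
      Matrix.mul_nonsing_inv _ ((Matrix.isUnit_iff_isUnit_det _).1 (hinv y t)), Matrix.mul_one]
  have h1 := aux_trace_deriv _ _ _ _ t ht hxt (hinv x t)
  have h2 := aux_trace_deriv _ _ _ _ x hx htx (hinv x t)
  unfold pdt at h1 h2 ⊢
  unfold pdx at h1 h2 ⊢
  unfold pdx at e1
  unfold pdt at e2
  simp only [e1, e2]
  rw [h1.deriv, h2.deriv, Matrix.trace_sub, Matrix.trace_sub]
  congr 1
  rw [← Matrix.mul_assoc, ← Matrix.mul_assoc, Matrix.mul_assoc (_ * _), Matrix.trace_mul_comm,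
    ← Matrix.mul_assoc, ← Matrix.mul_assoc]
  simp only [Matrix.mul_assoc]
end

section
/- Let n ≥ 1, λ ∈ {1,−1}, and let R : ℝ × ℝ → ℂ^{n×1} be continuously differentiable. Define Q(x,t) = [[0, R(x,t)],[λ R(x,t)†, 0]], Q̃(x,t) = Q(−x,t), and Σ₃ = diag(Iₙ, −1). Suppose A : ℝ × ℝ → M_{n+1}(ℂ) is continuously differentiable, with block decomposition A = [[A₁, A₂],[A₃, A₄]] (A₁ is n×n, A₂ is n×1, A₃ is 1×n, A₄ is a scalar), and satisfies i[Σ₃, A(x,t)] = Q̃(x,t) − Q(x,t) and ∂ₓA(x,t) = Q̃(x,t)A(x,t) − A(x,t)Q(x,t) for all (x,t). Then: (i) 2i A₂(x,t) = R(−x,t) − R(x,t); (ii) −2i A₃(x,t) = λ(R(−x,t)† − R(x,t)†), so A₃ = λ A₂†; (iii) ∂ₓR(0,t) = −i(A₄(0,t) Iₙ − A₁(0,t)) R(0,t) for all t; and (iv) (∂ₓR)(0,t)† = i R(0,t)† (A₁(0,t) − A₄(0,t) Iₙ) for all t. -/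
open Matrix Complex

attribute [local instance] Matrix.normedAddCommGroup Matrix.normedSpace

theorem entry_hasDerivAt {m k : Type} [Fintype m] [Fintype k] (f : ℝ → Matrix m k ℂ) (x : ℝ)
    (hf : DifferentiableAt ℝ f x) (i : m) (j : k) :
    HasDerivAt (fun y => f y i j) (deriv f x i j) x :=
  hasDerivAt_pi.1 (hasDerivAt_pi.1 hf.hasDerivAt i) j

/-- Consequences of the Bäcklund relations `i[Σ₃,A] = Q̃ − Q`, `Aₓ = Q̃A − AQ` under the
mirror reduction `Q̃(x,t) = Q(−x,t)`: the off-diagonal blocks of `A` are determined by `R`,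
`A₃ = λA₂†`, and at `x = 0` one gets the boundary conditions
`Rₓ(0,t) = −i(A₄Iₙ − A₁)R(0,t)` and `Rₓ(0,t)† = iR(0,t)†(A₁ − A₄Iₙ)`. -/
theorem backlund_boundary_relations (n : ℕ) (hn : 1 ≤ n) (lam : ℝ)
    (hlam : lam = 1 ∨ lam = -1)
    (R : ℝ → ℝ → Matrix (Fin n) (Fin 1) ℂ)
    (hR : ContDiff ℝ 1 (fun p : ℝ × ℝ => R p.1 p.2))
    (A₁ : ℝ → ℝ → Matrix (Fin n) (Fin n) ℂ)
    (A₂ : ℝ → ℝ → Matrix (Fin n) (Fin 1) ℂ)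
    (A₃ : ℝ → ℝ → Matrix (Fin 1) (Fin n) ℂ)
    (A₄ : ℝ → ℝ → ℂ)
    (hA : ContDiff ℝ 1 (fun p : ℝ × ℝ =>
      Matrix.fromBlocks (A₁ p.1 p.2) (A₂ p.1 p.2) (A₃ p.1 p.2) (A₄ p.1 p.2 • 1)))
    (hrel1 : ∀ x t : ℝ,
      Complex.I •
          (Sigma3 n *
              Matrix.fromBlocks (A₁ x t) (A₂ x t) (A₃ x t) (A₄ x t • 1)
            - Matrix.fromBlocks (A₁ x t) (A₂ x t) (A₃ x t) (A₄ x t • 1) * Sigma3 n)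
        = Qmat lam R (-x) t - Qmat lam R x t)
    (hrel2 : ∀ x t : ℝ,
      pdx (fun x t => Matrix.fromBlocks (A₁ x t) (A₂ x t) (A₃ x t) (A₄ x t • 1)) x t
        = Qmat lam R (-x) t * Matrix.fromBlocks (A₁ x t) (A₂ x t) (A₃ x t) (A₄ x t • 1)
          - Matrix.fromBlocks (A₁ x t) (A₂ x t) (A₃ x t) (A₄ x t • 1) * Qmat lam R x t) :
    (∀ x t : ℝ, (2 * Complex.I) • A₂ x t = R (-x) t - R x t)
    ∧ (∀ x t : ℝ,
        (-(2 * Complex.I)) • A₃ x t = (lam : ℂ) • ((R (-x) t)ᴴ - (R x t)ᴴ))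
    ∧ (∀ x t : ℝ, A₃ x t = (lam : ℂ) • (A₂ x t)ᴴ)
    ∧ (∀ t : ℝ,
        pdx R 0 t = (-Complex.I) • ((A₄ 0 t • 1 - A₁ 0 t) * R 0 t))
    ∧ (∀ t : ℝ,
        (pdx R 0 t)ᴴ = Complex.I • ((R 0 t)ᴴ * (A₁ 0 t - A₄ 0 t • 1))) := by
  have h1 : ∀ x t : ℝ, (2 * Complex.I) • A₂ x t = R (-x) t - R x t := by
    intro x t
    ext i j
    have h := congrFun (congrFun (hrel1 x t) (Sum.inl i)) (Sum.inr j)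
    simp [Sigma3, Qmat, Matrix.fromBlocks_multiply] at h
    simp only [Matrix.smul_apply, Matrix.sub_apply, smul_eq_mul]
    linear_combination h
  have h2 : ∀ x t : ℝ,
      (-(2 * Complex.I)) • A₃ x t = (lam : ℂ) • ((R (-x) t)ᴴ - (R x t)ᴴ) := by
    intro x t
    ext i j
    have h := congrFun (congrFun (hrel1 x t) (Sum.inr i)) (Sum.inl j)
    simp [Sigma3, Qmat, Matrix.fromBlocks_multiply] at h
    simp only [Matrix.smul_apply, Matrix.sub_apply, smul_eq_mul, Matrix.conjTranspose_apply,
      RCLike.star_def]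
    linear_combination h
  have h3 : ∀ x t : ℝ, A₃ x t = (lam : ℂ) • (A₂ x t)ᴴ := by
    intro x t
    ext i j
    have ha := congrArg star (congrFun (congrFun (h1 x t) j) i)
    have hb := congrFun (congrFun (h2 x t) i) j
    simp at ha hb
    simp only [Matrix.smul_apply, smul_eq_mul, Matrix.conjTranspose_apply, RCLike.star_def]
    have hI : (-(2 * Complex.I)) ≠ 0 := by simp
    apply mul_left_cancel₀ hI
    linear_combination hb - (lam : ℂ) * ha
  have hRd : ∀ x t : ℝ, DifferentiableAt ℝ (fun y => R y t) x := by
    intro x t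
    exact ((hR.differentiable one_ne_zero).comp
      (differentiable_id.prodMk (differentiable_const t))) x
  have hAd : ∀ x t : ℝ, DifferentiableAt ℝ (fun y =>
      Matrix.fromBlocks (A₁ y t) (A₂ y t) (A₃ y t)
        (A₄ y t • (1 : Matrix (Fin 1) (Fin 1) ℂ))) x := by
    intro x t
    exact ((hA.differentiable one_ne_zero).comp
      (differentiable_id.prodMk (differentiable_const t))) x
  have hRe : ∀ t i j, HasDerivAt (fun y => R y t i j) (pdx R 0 t i j) 0 :=
    fun t i j => entry_hasDerivAt _ _ (hRd 0 t) i j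
  have hRn : ∀ t i j, HasDerivAt (fun y => R (-y) t i j) (-(pdx R 0 t i j)) 0 := by
    intro t i j
    have h := hRe t i j
    rw [← neg_zero] at h
    have h' := HasDerivAt.scomp (𝕜 := ℝ) (0 : ℝ) h (hasDerivAt_neg (0 : ℝ))
    rw [neg_zero, neg_one_smul] at h'
    exact h'
  refine ⟨h1, h2, h3, ?_, ?_⟩
  · intro t
    ext i j
    have h := entry_hasDerivAt _ _ (hAd 0 t) (Sum.inl i) (Sum.inr j)
    have e : deriv (fun y => Matrix.fromBlocks (A₁ y t) (A₂ y t) (A₃ y t)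
        (A₄ y t • (1 : Matrix (Fin 1) (Fin 1) ℂ))) 0 = _ := hrel2 0 t
    rw [e] at h
    simp only [Matrix.fromBlocks_apply₁₂] at h
    have hc := h.const_mul (2 * Complex.I)
    have hd := (hRn t i j).sub (hRe t i j)
    have hf : (fun y => 2 * Complex.I * A₂ y t i j)
        = (fun y => R (-y) t i j) - (fun y => R y t i j) := by
      funext y
      exact congrFun (congrFun (h1 y t) i) j
    rw [hf] at hc
    have hu := hc.unique hd
    simp [Qmat, Matrix.fromBlocks_multiply] at hu
    simp [Matrix.sub_mul]
    linear_combination (1/2) * hu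
  · intro t
    ext i j
    have h := entry_hasDerivAt _ _ (hAd 0 t) (Sum.inr i) (Sum.inl j)
    have e : deriv (fun y => Matrix.fromBlocks (A₁ y t) (A₂ y t) (A₃ y t)
        (A₄ y t • (1 : Matrix (Fin 1) (Fin 1) ℂ))) 0 = _ := hrel2 0 t
    rw [e] at h
    simp only [Matrix.fromBlocks_apply₂₁] at h
    have hc := h.const_mul (-(2 * Complex.I))
    have hd := ((hRn t j i).star.sub (hRe t j i).star).const_mul (lam : ℂ)
    have hf : (fun y => -(2 * Complex.I) * A₃ y t i j)
        = (fun y => (lam : ℂ) * ((fun y => star (R (-y) t j i)) - (fun y => star (R y t j i))) y) := by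
      funext y
      exact congrFun (congrFun (h2 y t) i) j
    rw [hf] at hc
    have hu := hc.unique hd
    have hl : (lam : ℂ) * lam = 1 := by
      rcases hlam with h | h <;> simp [h]
    simp [Qmat, Matrix.fromBlocks_multiply] at hu
    simp [Matrix.mul_sub]
    have hl0 : (lam : ℂ) ≠ 0 := left_ne_zero_of_mul_eq_one hl
    apply mul_left_cancel₀ hl0
    linear_combination (1/2) * hu
end

section
/- Let n ≥ 1, let Ω ⊆ ℂ be closed under k ↦ −k, and let B : Ω → Mₙ(ℂ) satisfy B(−k) B(k) = Iₙ for all k ∈ Ω. Define 𝓑(k) = diag(B(k), −1) ∈ M_{n+1}(ℂ) and Σ₃ = diag(Iₙ, −1). Let P : ℝ × Ω → M_{n+1}(ℂ) satisfy the symmetry P(−x, −k) = −𝓑(−k) P(x,k) 𝓑(k) for all x ∈ ℝ, k ∈ Ω, and suppose M : ℝ × Ω → M_{n+1}(ℂ) is differentiable in x and satisfies ∂ₓM(x,k) + ik[Σ₃, M(x,k)] = P(x,k) M(x,k) for all x ∈ ℝ, k ∈ Ω. Then N(x,k) := 𝓑(k) M(−x, −k) 𝓑(−k) satisfies the same equation: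 ∂ₓN(x,k) + ik[Σ₃, N(x,k)] = P(x,k) N(x,k) for all x ∈ ℝ, k ∈ Ω. -/
open Matrix Complex

attribute [local instance] Matrix.normedAddCommGroup Matrix.normedSpace

/-- `𝓑(k) = diag(B(k), −1)`. -/
noncomputable def calB {n : ℕ} (B : ℂ → Matrix (Fin n) (Fin n) ℂ) (k : ℂ) :
    Matrix (Fin n ⊕ Fin 1) (Fin n ⊕ Fin 1) ℂ :=
  Matrix.fromBlocks (B k) 0 0 (-1)

/-- If `M` solves `Mₓ + ik[Σ₃,M] = PM` and the extended potential `P` has the mirror symmetry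
`P(−x,−k) = −𝓑(−k)P(x,k)𝓑(k)`, then `N(x,k) = 𝓑(k)M(−x,−k)𝓑(−k)` solves the same equation. -/
theorem mirror_jost_symmetry (n : ℕ) (hn : 1 ≤ n) (Ω : Set ℂ)
    (hΩ : ∀ k ∈ Ω, -k ∈ Ω)
    (B : ℂ → Matrix (Fin n) (Fin n) ℂ)
    (hB : ∀ k ∈ Ω, B (-k) * B k = 1)
    (P : ℝ → ℂ → Matrix (Fin n ⊕ Fin 1) (Fin n ⊕ Fin 1) ℂ)
    (hP : ∀ (x : ℝ), ∀ k ∈ Ω, P (-x) (-k) = -(calB B (-k) * P x k * calB B k))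
    (M : ℝ → ℂ → Matrix (Fin n ⊕ Fin 1) (Fin n ⊕ Fin 1) ℂ)
    (hMdiff : ∀ k ∈ Ω, Differentiable ℝ (fun x => M x k))
    (hM : ∀ (x : ℝ), ∀ k ∈ Ω,
      deriv (fun y => M y k) x
        + (Complex.I * k) • (Sigma3 n * M x k - M x k * Sigma3 n)
        = P x k * M x k) :
    ∀ (x : ℝ), ∀ k ∈ Ω,
      deriv (fun y => calB B k * M (-y) (-k) * calB B (-k)) x
        + (Complex.I * k) •
          (Sigma3 n * (calB B k * M (-x) (-k) * calB B (-k))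
            - (calB B k * M (-x) (-k) * calB B (-k)) * Sigma3 n)
        = P x k * (calB B k * M (-x) (-k) * calB B (-k)) := by
  intro x k hk
  have hk' := hΩ k hk
  have hBB : calB B k * calB B (-k) = 1 := by
    have h := hB (-k) hk'
    rw [neg_neg] at h
    simp [calB, Matrix.fromBlocks_multiply, h]
  have hc : ∀ q, Sigma3 n * calB B q = calB B q * Sigma3 n := by
    intro q
    simp [calB, Sigma3, Matrix.fromBlocks_multiply]
  have hd : deriv (fun y => calB B k * M (-y) (-k) * calB B (-k)) x
      = -(calB B k * deriv (fun y => M y (-k)) (-x) * calB B (-k)) := by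
    have h1 : HasDerivAt (fun y => M y (-k)) (deriv (fun y => M y (-k)) (-x)) (-x) :=
      (hMdiff (-k) hk' (-x)).hasDerivAt
    have h2 : HasDerivAt (fun y : ℝ => M (-y) (-k)) (-(deriv (fun y => M y (-k)) (-x))) x := by
      have := h1.scomp x (hasDerivAt_neg x)
      rw [neg_one_smul] at this
      exact this
    let L : Matrix (Fin n ⊕ Fin 1) (Fin n ⊕ Fin 1) ℂ →ₗ[ℝ]
        Matrix (Fin n ⊕ Fin 1) (Fin n ⊕ Fin 1) ℂ :=
      (LinearMap.mulRight ℝ (calB B (-k))).comp (LinearMap.mulLeft ℝ (calB B k))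
    have h3 := (LinearMap.toContinuousLinearMap L).hasFDerivAt.comp_hasDerivAt x h2
    have h4 := h3.deriv
    have h5 : L (-(deriv (fun y => M y (-k)) (-x)))
        = -(calB B k * deriv (fun y => M y (-k)) (-x) * calB B (-k)) := by
      simp [L]
    exact h4.trans h5
  have hm := hM (-x) (-k) hk'
  rw [hP x k hk] at hm
  have hm' := eq_sub_of_add_eq hm
  rw [hd, hm']
  generalize M (-x) (-k) = m
  have e1 : calB B k * (-(calB B (-k) * P x k * calB B k) * m) * calB B (-k)
      = -(P x k * (calB B k * m * calB B (-k))) := by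
    calc _ = -((calB B k * calB B (-k)) * (P x k * (calB B k * m * calB B (-k)))) := by
          noncomm_ring
      _ = _ := by rw [hBB, one_mul]
  have e2 : calB B k * (Sigma3 n * m - m * Sigma3 n) * calB B (-k)
      = Sigma3 n * (calB B k * m * calB B (-k)) - (calB B k * m * calB B (-k)) * Sigma3 n := by
    calc _ = (calB B k * Sigma3 n) * m * calB B (-k)
            - calB B k * m * (Sigma3 n * calB B (-k)) := by noncomm_ring
      _ = _ := by rw [hc (-k), ← hc k]; noncomm_ring
  rw [mul_sub, sub_mul, e1, mul_smul_comm, smul_mul_assoc, e2, mul_neg, neg_smul]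
  abel
end

section
/- Let n ≥ 1, let κ₁, κ₂ ∈ ℂ with κ₂ ∉ ℝ (so κ₂ ≠ κ₂*), κ₂ ≠ κ₁ and κ₂ ≠ κ₁*, and let Π₁, Π₂ ∈ Mₙ(ℂ) satisfy Πⱼ² = Πⱼ and tr Πⱼ = 1. Define Dⱼ(k) = Iₙ + ((k − κⱼ)/(k − κⱼ*) − 1) Πⱼ for k ≠ κⱼ* and a(k) = D₁(k) D₂(k). Then D₁(κ₂) is invertible and the adjugate (transpose of the cofactor matrix) of a(κ₂) satisfies adj(a(κ₂)) = ((κ₂ − κ₁)/(κ₂ − κ₁*)) Π₂ D₁(κ₂)⁻¹; equivalently, adj(a(κ₂)) = α′(κ₂)(κ₂ − κ₂*) Π₂ D₁(κ₂)⁻¹, where α′(κ₂) = (κ₂ − κ₁)/((κ₂ − κ₁*)(κ₂ − κ₂*)) is the derivative at κ₂ of k ↦ ((k−κ₁)(k−κ₂))/((k−κ₁*)(k−κ₂*)). -/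
open Matrix Complex

theorem aux_decomp {n : ℕ} (P : Matrix (Fin n) (Fin n) ℂ) (hP : P * P = P) (ht : P.trace = 1) :
    ∃ u v : Fin n → ℂ, P = vecMulVec u v := by
  have hid : IsIdempotentElem (Matrix.toLin' P) := by
    unfold IsIdempotentElem
    rw [Module.End.mul_eq_comp, ← Matrix.toLin'_mul, hP]
  have h1 := (LinearMap.IsIdempotentElem.isProj_range _ hid).trace
  rw [Matrix.trace_toLin'_eq, ht] at h1
  have h2 : Module.finrank ℂ (LinearMap.range (Matrix.toLin' P)) = 1 := by exact_mod_cast h1.symm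
  obtain ⟨u, -, hu⟩ := finrank_eq_one_iff'.1 h2
  have h3 : ∀ j, ∃ c : ℂ, c • (u : Fin n → ℂ) = P *ᵥ Pi.single j 1 := by
    intro j
    obtain ⟨c, hc⟩ := hu ⟨Matrix.toLin' P (Pi.single j 1), LinearMap.mem_range_self _ _⟩
    exact ⟨c, by simpa using congrArg Subtype.val hc⟩
  choose v hv using h3
  refine ⟨u, v, ?_⟩
  ext i j
  have := congrFun (hv j) i
  simp at this
  rw [vecMulVec_apply, ← this, mul_comm]

theorem aux_det_s15 {n : ℕ} (P : Matrix (Fin n) (Fin n) ℂ) (hP : P * P = P) (ht : P.trace = 1)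
    (t : ℂ) : (1 + t • P).det = 1 + t := by
  obtain ⟨u, v, rfl⟩ := aux_decomp P hP ht
  rw [← smul_vecMulVec, vecMulVec_eq Unit, det_one_add_replicateCol_mul_replicateRow]
  rw [trace_vecMulVec, dotProduct_comm] at ht
  simp [ht]

theorem aux_adj {n : ℕ} (P : Matrix (Fin n) (Fin n) ℂ) (hP : P * P = P) (ht : P.trace = 1) :
    (1 + (-1 : ℂ) • P).adjugate = P := by
  have key : (fun t : ℂ => (1 + t • P).adjugate) = fun t : ℂ => (1 + t) • 1 - t • P := by
    refine Continuous.ext_on (dense_compl_singleton (-1 : ℂ)) ?_ ?_ ?_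
    · exact Continuous.matrix_adjugate (by fun_prop)
    · fun_prop
    · intro t h
      have h0 : (1 + t • P).det ≠ 0 := by
        rw [aux_det_s15 P hP ht]
        intro h'
        exact h (by simpa using eq_neg_of_add_eq_zero_right h')
      have hu : IsUnit (1 + t • P) := (Matrix.isUnit_iff_isUnit_det _).2 h0.isUnit
      apply hu.mul_left_cancel
      rw [mul_adjugate, aux_det_s15 P hP ht]
      simp only [add_mul, mul_sub, one_mul, Matrix.mul_smul, Matrix.smul_mul, mul_one, hP]
      module
  simpa using congrFun key (-1)

/-- In the dressing-method construction of two-soliton solutions of the vector NLS equation,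
with `Dⱼ(k) = I + ((k−κⱼ)/(k−κⱼ*) − 1)Πⱼ` for rank-one projectors and `a(k) = D₁(k)D₂(k)`,
the matrix `D₁(κ₂)` is invertible and the adjugate of `a(κ₂)` satisfies
`adj(a(κ₂)) = ((κ₂−κ₁)/(κ₂−κ₁*)) Π₂ D₁(κ₂)⁻¹ = α′(κ₂)(κ₂−κ₂*) Π₂ D₁(κ₂)⁻¹`, where
`α′(κ₂) = (κ₂−κ₁)/((κ₂−κ₁*)(κ₂−κ₂*))` is the derivative at `κ₂` of
`k ↦ ((k−κ₁)(k−κ₂))/((k−κ₁*)(k−κ₂*))`. -/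
theorem dressing_adjugate_formula (n : ℕ) (hn : 1 ≤ n) (κ₁ κ₂ : ℂ)
    (hκ₂real : κ₂ ≠ (starRingEnd ℂ) κ₂)
    (hκ₂κ₁ : κ₂ ≠ κ₁) (hκ₂κ₁s : κ₂ ≠ (starRingEnd ℂ) κ₁)
    (P₁ P₂ : Matrix (Fin n) (Fin n) ℂ)
    (hP₁ : P₁ * P₁ = P₁) (hP₂ : P₂ * P₂ = P₂)
    (htr₁ : P₁.trace = 1) (htr₂ : P₂.trace = 1) :
    IsUnit (1 + ((κ₂ - κ₁) / (κ₂ - (starRingEnd ℂ) κ₁) - 1) • P₁)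
    ∧
    Matrix.adjugate
        ((1 + ((κ₂ - κ₁) / (κ₂ - (starRingEnd ℂ) κ₁) - 1) • P₁) *
          (1 + ((κ₂ - κ₂) / (κ₂ - (starRingEnd ℂ) κ₂) - 1) • P₂))
      = ((κ₂ - κ₁) / (κ₂ - (starRingEnd ℂ) κ₁)) •
          (P₂ * (1 + ((κ₂ - κ₁) / (κ₂ - (starRingEnd ℂ) κ₁) - 1) • P₁)⁻¹)
    ∧
    Matrix.adjugate
        ((1 + ((κ₂ - κ₁) / (κ₂ - (starRingEnd ℂ) κ₁) - 1) • P₁) *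
          (1 + ((κ₂ - κ₂) / (κ₂ - (starRingEnd ℂ) κ₂) - 1) • P₂))
      = (((κ₂ - κ₁) / ((κ₂ - (starRingEnd ℂ) κ₁) * (κ₂ - (starRingEnd ℂ) κ₂)))
            * (κ₂ - (starRingEnd ℂ) κ₂)) •
          (P₂ * (1 + ((κ₂ - κ₁) / (κ₂ - (starRingEnd ℂ) κ₁) - 1) • P₁)⁻¹)
    ∧
    HasDerivAt
      (fun k : ℂ =>
        ((k - κ₁) * (k - κ₂)) / ((k - (starRingEnd ℂ) κ₁) * (k - (starRingEnd ℂ) κ₂)))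
      ((κ₂ - κ₁) / ((κ₂ - (starRingEnd ℂ) κ₁) * (κ₂ - (starRingEnd ℂ) κ₂))) κ₂ := by
  have e1 : κ₂ - (starRingEnd ℂ) κ₁ ≠ 0 := sub_ne_zero.2 hκ₂κ₁s
  have e2 : κ₂ - (starRingEnd ℂ) κ₂ ≠ 0 := sub_ne_zero.2 hκ₂real
  have e3 : κ₂ - κ₁ ≠ 0 := sub_ne_zero.2 hκ₂κ₁
  have hd := aux_det_s15 P₁ hP₁ htr₁ ((κ₂ - κ₁) / (κ₂ - (starRingEnd ℂ) κ₁) - 1)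
  rw [add_sub_cancel] at hd
  have hdu : IsUnit (1 + ((κ₂ - κ₁) / (κ₂ - (starRingEnd ℂ) κ₁) - 1) • P₁).det := by
    rw [hd]; exact (div_ne_zero e3 e1).isUnit
  have main : Matrix.adjugate
        ((1 + ((κ₂ - κ₁) / (κ₂ - (starRingEnd ℂ) κ₁) - 1) • P₁) *
          (1 + ((κ₂ - κ₂) / (κ₂ - (starRingEnd ℂ) κ₂) - 1) • P₂))
      = ((κ₂ - κ₁) / (κ₂ - (starRingEnd ℂ) κ₁)) •
          (P₂ * (1 + ((κ₂ - κ₁) / (κ₂ - (starRingEnd ℂ) κ₁) - 1) • P₁)⁻¹) := by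
    rw [adjugate_mul_distrib, sub_self, zero_div, zero_sub, aux_adj P₂ hP₂ htr₂,
      ← Matrix.mul_smul]
    congr 1
    rw [Matrix.inv_def, smul_smul, hd, Ring.mul_inverse_cancel _ (div_ne_zero e3 e1).isUnit, one_smul]
  refine ⟨(Matrix.isUnit_iff_isUnit_det _).2 hdu, main, ?_, ?_⟩
  · rw [main]
    congr 1
    field_simp
  · have hN := ((hasDerivAt_id κ₂).sub_const κ₁).mul ((hasDerivAt_id κ₂).sub_const κ₂)
    have hD := ((hasDerivAt_id κ₂).sub_const ((starRingEnd ℂ) κ₁)).mul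
      ((hasDerivAt_id κ₂).sub_const ((starRingEnd ℂ) κ₂))
    have h := hN.div hD (mul_ne_zero e1 e2)
    refine h.congr_deriv ?_
    simp
    field_simp
end

section
/- Let n ≥ 1, k ∈ ℂ, and let R : ℝ × ℝ → ℂ^{n×1} be twice continuously differentiable and satisfy the free vector Schrödinger equation i ∂ₜR + ∂ₓ²R = 0 on ℝ². Suppose Γ⁰ : ℝ × ℝ → M_{1×n}(ℂ) is twice continuously differentiable and satisfies ∂ₓΓ⁰ = 2ik Γ⁰ + R† and ∂ₜΓ⁰ = 4ik² Γ⁰ + 2k R† − i (∂ₓR)† on ℝ². Then ∂ₜ(Γ⁰ R) = i ∂ₓ(Γ⁰ ∂ₓR − (∂ₓΓ⁰) R) holds on ℝ². -/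
open Matrix Complex

attribute [local instance] Matrix.normedAddCommGroup Matrix.normedSpace

theorem hasDerivAt_mat_aux {m l : ℕ} (F : ℝ → Matrix (Fin m) (Fin l) ℂ)
    (F' : Matrix (Fin m) (Fin l) ℂ) (x : ℝ) :
    HasDerivAt F F' x ↔ ∀ i j, HasDerivAt (fun y => F y i j) (F' i j) x := by
  have h1 := hasDerivAt_pi (𝕜 := ℝ) (φ := fun y => (F y : Fin m → Fin l → ℂ))
    (φ' := (F' : Fin m → Fin l → ℂ)) (x := x)
  refine Iff.trans h1 (forall_congr' fun i => ?_)
  exact hasDerivAt_pi (𝕜 := ℝ) (φ := fun y => (F y i : Fin l → ℂ))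
    (φ' := (F' i : Fin l → ℂ)) (x := x)

theorem hasDerivAt_mul_aux {m l r : ℕ} {F : ℝ → Matrix (Fin m) (Fin l) ℂ}
    {F' : Matrix (Fin m) (Fin l) ℂ} {G : ℝ → Matrix (Fin l) (Fin r) ℂ}
    {G' : Matrix (Fin l) (Fin r) ℂ} {x : ℝ}
    (hF : HasDerivAt F F' x) (hG : HasDerivAt G G' x) :
    HasDerivAt (fun y => F y * G y) (F' * G x + F x * G') x := by
  rw [hasDerivAt_mat_aux] at *
  intro i j
  simp only [Matrix.mul_apply, Matrix.add_apply, ← Finset.sum_add_distrib]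
  exact HasDerivAt.fun_sum fun c _ => (hF i c).mul (hG c j)

theorem hasDerivAt_conj_aux {m l : ℕ} {F : ℝ → Matrix (Fin m) (Fin l) ℂ}
    {F' : Matrix (Fin m) (Fin l) ℂ} {x : ℝ} (hF : HasDerivAt F F' x) :
    HasDerivAt (fun y => (F y)ᴴ) F'ᴴ x := by
  rw [hasDerivAt_mat_aux] at *
  intro i j
  exact (hF j i).star

theorem hasDerivAt_smul_aux {m l : ℕ} (c : ℂ) {F : ℝ → Matrix (Fin m) (Fin l) ℂ}
    {F' : Matrix (Fin m) (Fin l) ℂ} {x : ℝ} (hF : HasDerivAt F F' x) :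
    HasDerivAt (fun y => c • F y) (c • F') x := by
  rw [hasDerivAt_mat_aux] at *
  intro i j
  exact (hF i j).const_mul c

theorem hasDerivAt_x_aux {E : Type*} [NormedAddCommGroup E] [NormedSpace ℝ E]
    {F : ℝ → ℝ → E} (h : ContDiff ℝ 2 (fun p : ℝ × ℝ => F p.1 p.2)) (x t : ℝ) :
    HasDerivAt (fun y => F y t) (pdx F x t) x := by
  have hd := h.differentiable (by norm_num)
  have : Differentiable ℝ (fun y : ℝ => F y t) :=
    hd.comp (g := fun p : ℝ × ℝ => F p.1 p.2) (f := fun y : ℝ => (y, t)) (by fun_prop)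
  exact (this x).hasDerivAt

theorem hasDerivAt_t_aux {E : Type*} [NormedAddCommGroup E] [NormedSpace ℝ E]
    {F : ℝ → ℝ → E} (h : ContDiff ℝ 2 (fun p : ℝ × ℝ => F p.1 p.2)) (x t : ℝ) :
    HasDerivAt (fun s => F x s) (pdt F x t) t := by
  have hd := h.differentiable (by norm_num)
  have : Differentiable ℝ (fun s : ℝ => F x s) :=
    hd.comp (g := fun p : ℝ × ℝ => F p.1 p.2) (f := fun s : ℝ => (x, s)) (by fun_prop)
  exact (this t).hasDerivAt

theorem hasDerivAt_xx_aux {E : Type*} [NormedAddCommGroup E] [NormedSpace ℝ E]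
    {F : ℝ → ℝ → E} (h : ContDiff ℝ 2 (fun p : ℝ × ℝ => F p.1 p.2)) (x t : ℝ) :
    HasDerivAt (fun y => pdx F y t) (pdx (pdx F) x t) x := by
  have h2 : ContDiff ℝ 2 (fun y : ℝ => F y t) :=
    h.comp (g := fun p : ℝ × ℝ => F p.1 p.2) (f := fun y : ℝ => (y, t)) (by fun_prop)
  have h3 : ContDiff ℝ 1 (deriv (fun y : ℝ => F y t)) :=
    ContDiff.deriv' (n := 1) (by simpa [one_add_one_eq_two] using h2)
  exact (h3.differentiable (by norm_num) x).hasDerivAt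

/-- For the free vector Schrödinger equation, a solution `Γ⁰` of the linear (abelian) Lax
equations `Γ⁰ₓ = 2ikΓ⁰ + R†`, `Γ⁰ₜ = 4ik²Γ⁰ + 2kR† − i(∂ₓR)†` produces the local conservation
law `∂ₜ(Γ⁰R) = i∂ₓ(Γ⁰∂ₓR − (∂ₓΓ⁰)R)`. -/
theorem free_schrodinger_generating_conservation (n : ℕ) (hn : 1 ≤ n) (k : ℂ)
    (R : ℝ → ℝ → Matrix (Fin n) (Fin 1) ℂ)
    (hR : ContDiff ℝ 2 (fun p : ℝ × ℝ => R p.1 p.2))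
    (hfree : ∀ x t : ℝ, Complex.I • pdt R x t + pdx (pdx R) x t = 0)
    (Γ₀ : ℝ → ℝ → Matrix (Fin 1) (Fin n) ℂ)
    (hΓ₀ : ContDiff ℝ 2 (fun p : ℝ × ℝ => Γ₀ p.1 p.2))
    (hΓ₀x : ∀ x t : ℝ,
      pdx Γ₀ x t = (2 * Complex.I * k) • Γ₀ x t + (R x t)ᴴ)
    (hΓ₀t : ∀ x t : ℝ,
      pdt Γ₀ x t = (4 * Complex.I * k ^ 2) • Γ₀ x t + (2 * k) • (R x t)ᴴ
        - Complex.I • (pdx R x t)ᴴ) :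
    ∀ x t : ℝ,
      pdt (fun x t => Γ₀ x t * R x t) x t
        = Complex.I •
            pdx (fun x t => Γ₀ x t * pdx R x t - pdx Γ₀ x t * R x t) x t := by
  intro x t
  have hRx := hasDerivAt_x_aux hR x t
  have hRt := hasDerivAt_t_aux hR x t
  have hRxx := hasDerivAt_xx_aux hR x t
  have hGx := hasDerivAt_x_aux hΓ₀ x t
  have hGt := hasDerivAt_t_aux hΓ₀ x t
  have hGxx : HasDerivAt (fun y => pdx Γ₀ y t)
      ((2 * Complex.I * k) • pdx Γ₀ x t + (pdx R x t)ᴴ) x := by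
    simp_rw [fun y => hΓ₀x y t]
    rw [← hΓ₀x x t]
    exact (hasDerivAt_smul_aux _ hGx).add (hasDerivAt_conj_aux hRx)
  have e1 : pdt (fun x t => Γ₀ x t * R x t) x t = _ := (hasDerivAt_mul_aux hGt hRt).deriv
  have e2 : pdx (fun x t => Γ₀ x t * pdx R x t - pdx Γ₀ x t * R x t) x t = _ :=
    ((hasDerivAt_mul_aux hGx hRxx).sub (hasDerivAt_mul_aux hGxx hRx)).deriv
  have e3 : pdx (pdx R) x t = -(Complex.I • pdt R x t) :=
    (neg_eq_of_add_eq_zero_right (hfree x t)).symm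
  rw [e1, e2, e3, hΓ₀t, hΓ₀x]
  ext i j
  simp only [Matrix.add_mul, Matrix.sub_mul, Matrix.mul_neg, Matrix.smul_mul, Matrix.mul_smul,
    Matrix.add_apply, Matrix.sub_apply, Matrix.smul_apply, Matrix.neg_apply, smul_eq_mul,
    smul_add]
  linear_combination (4 * Complex.I * k ^ 2 * (Γ₀ x t * R x t) i j
    + 2 * k * ((R x t)ᴴ * R x t) i j + (Γ₀ x t * pdt R x t) i j) * Complex.I_sq
end

section
/- Let n ≥ 1 and let B ∈ Mₙ(ℝ) be a diagonal matrix with all diagonal entries equal to ±1 (so B² = Iₙ and B† = B). Let R : ℝ → ℂ^{n×1} be continuously differentiable with R(−x) = B R(x) for all x ∈ ℝ, and let Γ : ℝ × ℂ → M_{1×n}(ℂ) be continuously differentiable in x with Γ(x,k) = −Γ(−x,−k) B for all x ∈ ℝ, k ∈ ℂ. Then for every k ∈ ℂ the boundary combination i(∂ₓΓ(0,k) − ∂ₓΓ(0,−k)) R(0) − i(Γ(0,k) − Γ(0,−k)) ∂ₓR(0) + i(Γ(0,k) R(0) Γ(0,k) R(0) − Γ(0,−k) R(0) Γ(0,−k)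 R(0)) vanishes. -/
open Matrix Complex

attribute [local instance] Matrix.normedAddCommGroup Matrix.normedSpace

/-- For mixed Neumann/Dirichlet boundary conditions encoded by a diagonal matrix `B` with
`±1` entries, the mirror symmetries `R(−x) = BR(x)` and `Γ(x,k) = −Γ(−x,−k)B` make the
boundary term in the time derivative of the generating function of conserved quantities
vanish at `x = 0`. -/
theorem mixed_bc_boundary_term_vanishes (n : ℕ) (hn : 1 ≤ n)
    (B : Matrix (Fin n) (Fin n) ℂ)
    (hBdiag : ∀ i j : Fin n, i ≠ j → B i j = 0)
    (hBpm : ∀ i : Fin n, B i i = 1 ∨ B i i = -1)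
    (R : ℝ → Matrix (Fin n) (Fin 1) ℂ)
    (hR : ContDiff ℝ 1 R)
    (hRsym : ∀ x : ℝ, R (-x) = B * R x)
    (Γ : ℝ → ℂ → Matrix (Fin 1) (Fin n) ℂ)
    (hΓ : ∀ k : ℂ, ContDiff ℝ 1 (fun x => Γ x k))
    (hΓsym : ∀ (x : ℝ) (k : ℂ), Γ x k = -(Γ (-x) (-k) * B)) :
    ∀ k : ℂ,
      Complex.I •
          ((deriv (fun y => Γ y k) 0 - deriv (fun y => Γ y (-k)) 0) * R 0)
        - Complex.I • ((Γ 0 k - Γ 0 (-k)) * deriv R 0)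
        + Complex.I •
            (Γ 0 k * R 0 * (Γ 0 k * R 0) - Γ 0 (-k) * R 0 * (Γ 0 (-k) * R 0))
        = 0 := by
  intro k
  have hR1 : HasDerivAt R (deriv R 0) 0 :=
    (hR.differentiable (by norm_num) 0).hasDerivAt
  have hG1 : ∀ k : ℂ, HasDerivAt (fun x => Γ x k) (deriv (fun x => Γ x k) 0) 0 := fun k =>
    ((hΓ k).differentiable (by norm_num) 0).hasDerivAt
  have hR' : B * deriv R 0 = - deriv R 0 := by
    let L : Matrix (Fin n) (Fin 1) ℂ →ₗ[ℝ] Matrix (Fin n) (Fin 1) ℂ :=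
      { toFun := fun M => B * M
        map_add' := fun M N => Matrix.mul_add B M N
        map_smul' := fun c M => Matrix.mul_smul B c M }
    have h1 : HasDerivAt (fun x => B * R x) (B * deriv R 0) 0 :=
      (LinearMap.toContinuousLinearMap L).hasFDerivAt.comp_hasDerivAt (0 : ℝ) hR1
    have h2 : HasDerivAt (fun x : ℝ => R (-x)) (-deriv R 0) 0 := by
      have h3 : HasDerivAt R (deriv R 0) (-(0 : ℝ)) := by rw [neg_zero]; exact hR1
      have := h3.scomp (0 : ℝ) (hasDerivAt_neg (0 : ℝ))
      rw [neg_one_smul] at this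
      exact this
    rw [funext hRsym] at h2
    exact h1.unique h2
  have hG' : deriv (fun x => Γ x k) 0 = deriv (fun x => Γ x (-k)) 0 * B := by
    let L : Matrix (Fin 1) (Fin n) ℂ →ₗ[ℝ] Matrix (Fin 1) (Fin n) ℂ :=
      { toFun := fun M => -(M * B)
        map_add' := fun M N => by rw [Matrix.add_mul, neg_add]
        map_smul' := fun c M => by rw [Matrix.smul_mul, RingHom.id_apply, smul_neg] }
    have h2 : HasDerivAt (fun x : ℝ => Γ (-x) (-k)) (-deriv (fun x => Γ x (-k)) 0) 0 := by
      have h3 : HasDerivAt (fun x => Γ x (-k)) (deriv (fun x => Γ x (-k)) 0) (-(0 : ℝ)) := by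
        rw [neg_zero]; exact hG1 (-k)
      have := h3.scomp (0 : ℝ) (hasDerivAt_neg (0 : ℝ))
      rw [neg_one_smul] at this
      exact this
    have h1 : HasDerivAt (fun x => -(Γ (-x) (-k) * B))
        (-((-deriv (fun x => Γ x (-k)) 0) * B)) 0 :=
      (LinearMap.toContinuousLinearMap L).hasFDerivAt.comp_hasDerivAt (0 : ℝ) h2
    rw [← funext (fun x => hΓsym x k)] at h1
    rw [(hG1 k).unique h1, Matrix.neg_mul, neg_neg]
  have hR0 : B * R 0 = R 0 := by
    have := hRsym 0
    rw [neg_zero] at this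
    exact this.symm
  have hG0 : Γ 0 k = -(Γ 0 (-k) * B) := by
    have := hΓsym 0 k
    rwa [neg_zero] at this
  rw [hG', hG0]
  simp only [Matrix.sub_mul, Matrix.neg_mul, Matrix.mul_assoc, hR0, hR', Matrix.mul_neg]
  simp
end
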